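/- Let V ∈ C²(X×Y) be nonnegative, κ > 0, τ > 0, ν a probability measure on Y, and μ a probability measure on X with Lebesgue density bounded above and bounded away from zero. Let ρ̄ ∈ Γ(μ,ν) and let ρ be the minimizer over Γ(μ,ν) of E_τ(·|ρ̄) := (1/2τ) W_F(·,ρ̄)² + ∫ V d(·) + κ H(·|ν). Then ρ is absolutely continuous with respect to 𝓛⊗ν and its density r satisfies r(x,y) > 0 for μ⊗ν-almost every (x,y) ∈ X×Y. -/

import Mathlib

open MeasureTheory ProbabilityTheory Filter Set
open scoped ENNReal Topology

noncomputable section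

abbrev Euc (n : ℕ) : Type := EuclideanSpace ℝ (Fin n)

/-- The set of couplings (transport plans) between two measures. -/
def Couplings {α β : Type*} [MeasurableSpace α] [MeasurableSpace β]
    (μ : Measure α) (ν : Measure β) : Set (Measure (α × β)) :=
  {γ | IsProbabilityMeasure γ ∧ γ.map Prod.fst = μ ∧ γ.map Prod.snd = ν}

/-- Optimal transport cost between two measures for cost `c`. -/
def transportCost {α β : Type*} [MeasurableSpace α] [MeasurableSpace β]
    (c : α → β → ℝ≥0∞) (μ : Measure α) (ν : Measure β) : ℝ≥0∞ :=
  ⨅ γ ∈ Couplings μ ν, ∫⁻ p, c p.1 p.2 ∂γ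

/-- Squared 2-Wasserstein distance. -/
noncomputable def W2sq {α : Type*} [MeasurableSpace α] [PseudoEMetricSpace α]
    (μ ν : Measure α) : ℝ≥0∞ :=
  transportCost (fun a b => edist a b ^ 2) μ ν

/-- `K` is the disintegration of `ρ` with respect to its second marginal `ν`. -/
def IsDisint {α β : Type*} [MeasurableSpace α] [MeasurableSpace β]
    (ν : Measure β) (ρ : Measure (α × β)) (K : Kernel β α) : Prop :=
  IsMarkovKernel K ∧
    ∀ s : Set α, ∀ t : Set β, MeasurableSet s → MeasurableSet t →
      ρ (s ×ˢ t) = ∫⁻ y in t, K y s ∂ν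

/-- Squared fibered Wasserstein distance `W_F(ρ₁,ρ₂)² = ∫_Y W(ρ_{1,y},ρ_{2,y})² dν(y)`,
expressed through the (a.e.-unique) disintegrations of `ρ₁, ρ₂` w.r.t. `ν`. -/
noncomputable def WFsq {α β : Type*} [MeasurableSpace α] [PseudoEMetricSpace α]
    [MeasurableSpace β] (ν : Measure β) (ρ₁ ρ₂ : Measure (α × β)) : ℝ≥0∞ :=
  ⨅ (K₁ : Kernel β α) (K₂ : Kernel β α) (_ : IsDisint ν ρ₁ K₁) (_ : IsDisint ν ρ₂ K₂),
    ∫⁻ y, W2sq (K₁ y) (K₂ y) ∂ν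

/-- The integrand `s ↦ s log s − s + 1` of the entropy. -/
def entT (s : ℝ) : ℝ := s * Real.log s - s + 1

open scoped Classical in
/-- Weighted negative entropy of `ρ` relative to the reference measure `π`. -/
noncomputable def entropyH {α : Type*} [MeasurableSpace α] (π ρ : Measure α) : ℝ≥0∞ :=
  if ρ ≪ π then ∫⁻ p, ENNReal.ofReal (entT ((ρ.rnDeriv π p).toReal)) ∂π else ⊤

/-- The reference measure `𝓛|X ⊗ ν` on `X × Y`. -/
noncomputable def Lref {d d' : ℕ} (X : Set (Euc d)) (ν : Measure (Euc d')) :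
    Measure (Euc d × Euc d') :=
  (MeasureTheory.volume.restrict X).prod ν

/-- The minimizing movement functional
`E_τ(ρ | ρ̄) = (1/2τ) W_F(ρ, ρ̄)² + ∫ V dρ + κ H(ρ|ν)`. -/
noncomputable def JKOFun {d d' : ℕ} (X : Set (Euc d)) (ν : Measure (Euc d'))
    (V : Euc d × Euc d' → ℝ) (κ τ : ℝ) (ρbar ρ : Measure (Euc d × Euc d')) : ℝ≥0∞ :=
  ENNReal.ofReal (1 / (2 * τ)) * WFsq ν ρ ρbar
    + (∫⁻ p, ENNReal.ofReal (V p) ∂ρ) + ENNReal.ofReal κ * entropyH (Lref X ν) ρ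

theorem entT_eq_klFun : entT = InformationTheory.klFun := by
  ext s
  simp only [entT, InformationTheory.klFun]
  ring

theorem entT_nonneg {s : ℝ} (hs : 0 ≤ s) : 0 ≤ entT s := by
  rw [entT_eq_klFun]
  exact InformationTheory.klFun_nonneg hs

theorem measurable_entT : Measurable entT := by
  rw [entT_eq_klFun]
  exact InformationTheory.measurable_klFun

theorem entT_le_sq_add_one {s C : ℝ} (hs : 0 < s) (hsC : s ≤ C) : entT s ≤ C ^ 2 + 1 := by
  have h := mul_le_mul_of_nonneg_left (Real.log_le_sub_one_of_pos hs) hs.le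
  have h2 : s ^ 2 ≤ C ^ 2 := by gcongr
  simp only [entT]
  nlinarith

/-- Mixing in `g` with weight `t` lowers the entropy integrand by an extra `t |log t| g` where
`r` vanishes. -/
theorem entT_mix_le {r g t B : ℝ} (hr : 0 ≤ r) (hg : 0 ≤ g) (ht : 0 < t) (ht1 : t < 1)
    (hB : entT g ≤ B) :
    entT ((1 - t) * r + t * g) + (if r = 0 then t * -Real.log t * g else 0) ≤
      entT r + t * B := by
  split_ifs with h
  · subst h
    rcases hg.eq_or_lt with rfl | hg
    · simp [entT] at hB ⊢
      nlinarith
    · have : entT ((1 - t) * 0 + t * g) + t * -Real.log t * g = (1 - t) + t * entT g := by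
        simp only [entT, mul_zero, zero_add, Real.log_mul ht.ne' hg.ne']
        ring
      rw [this]
      have : entT 0 = 1 := by simp [entT]
      rw [this]
      nlinarith
  · have := InformationTheory.convexOn_klFun.2 (x := r) (y := g) hr hg
      (sub_nonneg.2 ht1.le) ht.le (by ring)
    rw [← entT_eq_klFun] at this
    simp only [smul_eq_mul] at this
    have := entT_nonneg hr
    nlinarith

theorem prod_mem_couplings {α β : Type*} [MeasurableSpace α] [MeasurableSpace β]
    (μ : Measure α) (ν : Measure β) [IsProbabilityMeasure μ] [IsProbabilityMeasure ν] :
    μ.prod ν ∈ Couplings μ ν :=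
  ⟨inferInstance, by simp, by simp⟩

theorem smul_add_smul_mem_couplings {α β : Type*} [MeasurableSpace α] [MeasurableSpace β]
    {μ₁ μ₂ : Measure α} {ν : Measure β} {γ₁ γ₂ : Measure (α × β)} {a b : ℝ≥0∞} (hab : a + b = 1)
    (h₁ : γ₁ ∈ Couplings μ₁ ν) (h₂ : γ₂ ∈ Couplings μ₂ ν) :
    a • γ₁ + b • γ₂ ∈ Couplings (a • μ₁ + b • μ₂) ν := by
  obtain ⟨p₁, f₁, s₁⟩ := h₁
  obtain ⟨p₂, f₂, s₂⟩ := h₂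
  refine ⟨⟨by simp [hab]⟩, ?_, ?_⟩
  · rw [Measure.map_add _ _ measurable_fst, Measure.map_smul, Measure.map_smul, f₁, f₂]
  · rw [Measure.map_add _ _ measurable_snd, Measure.map_smul, Measure.map_smul, s₁, s₂,
      ← add_smul, hab, one_smul]

theorem W2sq_smul_add_smul_le {α : Type*} [MeasurableSpace α] [PseudoEMetricSpace α]
    {μ₁ μ₂ ν : Measure α} {a b : ℝ≥0∞} (hab : a + b = 1) :
    W2sq (a • μ₁ + b • μ₂) ν ≤ W2sq μ₁ ν + b * W2sq μ₂ ν := by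
  have ha : a ≤ 1 := hab ▸ le_self_add
  have hb : b ≤ 1 := hab ▸ le_add_self
  by_cases hb0 : b = 0
  · have ha1 : a = 1 := by simpa [hb0] using hab
    simp [ha1, hb0]
  have hbt : b ≠ ⊤ := ne_top_of_le_ne_top ENNReal.one_ne_top hb
  simp only [W2sq, transportCost, ENNReal.mul_iInf_of_ne hb0 hbt, ENNReal.iInf_add,
    ENNReal.add_iInf]
  refine le_iInf₂ fun γ₂ h₂ => le_iInf₂ fun γ₁ h₁ =>
    (iInf₂_le _ (smul_add_smul_mem_couplings hab h₁ h₂)).trans ?_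
  rw [lintegral_add_measure, lintegral_smul_measure, lintegral_smul_measure, smul_eq_mul,
    smul_eq_mul]
  gcongr
  exact mul_le_of_le_one_left' ha

theorem W2sq_le_ediam_sq {α : Type*} [MeasurableSpace α] [PseudoEMetricSpace α]
    {μ ν : Measure α} [IsProbabilityMeasure μ] [IsProbabilityMeasure ν] {S : Set α}
    (hμ : μ Sᶜ = 0) (hν : ν Sᶜ = 0) : W2sq μ ν ≤ Metric.ediam S ^ 2 := by
  refine (iInf₂_le _ (prod_mem_couplings μ ν)).trans ?_
  have h₁ : ∀ᵐ p ∂μ.prod ν, p.1 ∈ S := Measure.quasiMeasurePreserving_fst.ae hμ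
  have h₂ : ∀ᵐ p ∂μ.prod ν, p.2 ∈ S := Measure.quasiMeasurePreserving_snd.ae hν
  calc ∫⁻ p, edist p.1 p.2 ^ 2 ∂μ.prod ν ≤ ∫⁻ _, Metric.ediam S ^ 2 ∂μ.prod ν := by
        refine lintegral_mono_ae ?_
        filter_upwards [h₁, h₂] with p hp hq
        gcongr
        exact Metric.edist_le_ediam_of_mem hp hq
    _ = Metric.ediam S ^ 2 := by simp

theorem exists_isDisint {d d' : ℕ} {μ : Measure (Euc d)} {ν : Measure (Euc d')}
    {ρ : Measure (Euc d × Euc d')} (hρ : ρ ∈ Couplings μ ν) :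
    ∃ K : Kernel (Euc d') (Euc d), IsDisint ν ρ K := by
  obtain ⟨hp, -, hs⟩ := hρ
  have : IsProbabilityMeasure (ρ.map Prod.swap) :=
    Measure.isProbabilityMeasure_map measurable_swap.aemeasurable
  have hfst : (ρ.map Prod.swap).fst = ν := by
    rw [Measure.fst, Measure.map_map measurable_fst measurable_swap, ← hs]
    rfl
  refine ⟨(ρ.map Prod.swap).condKernel, inferInstance, fun s t hs ht => ?_⟩
  have : IsProbabilityMeasure ν := hfst ▸ inferInstance
  have h := (ρ.map Prod.swap).disintegrate (ρ.map Prod.swap).condKernel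
  rw [hfst] at h
  rw [← Measure.compProd_apply_prod ht hs, h, Measure.map_apply measurable_swap (ht.prod hs),
    Set.preimage_swap_prod]

theorem isDisint_prod_const {α β : Type*} [MeasurableSpace α] [MeasurableSpace β]
    (μ : Measure α) (ν : Measure β) [IsProbabilityMeasure μ] [IsProbabilityMeasure ν] :
    IsDisint ν (μ.prod ν) (Kernel.const β μ) :=
  ⟨inferInstance, fun s t _ _ => by simp [Measure.prod_prod]⟩

theorem IsDisint.exists_smul_add_smul {α β : Type*} [MeasurableSpace α] [MeasurableSpace β]
    {ν : Measure β} {ρ₁ ρ₂ : Measure (α × β)} {K₁ K₂ : Kernel β α}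
    (h₁ : IsDisint ν ρ₁ K₁) (h₂ : IsDisint ν ρ₂ K₂) {a b : ℝ≥0∞} (hab : a + b = 1) :
    ∃ K : Kernel β α, IsDisint ν (a • ρ₁ + b • ρ₂) K ∧ ∀ y, K y = a • K₁ y + b • K₂ y := by
  obtain ⟨m₁, h₁⟩ := h₁
  obtain ⟨m₂, h₂⟩ := h₂
  have hmeas : Measurable fun y => a • K₁ y + b • K₂ y := by
    refine Measure.measurable_of_measurable_coe _ fun s hs => ?_
    simp only [Measure.coe_add, Measure.coe_smul, Pi.add_apply, Pi.smul_apply, smul_eq_mul]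
    exact ((K₁.measurable_coe hs).const_mul a).add ((K₂.measurable_coe hs).const_mul b)
  refine ⟨⟨_, hmeas⟩, ⟨⟨fun y => ⟨?_⟩⟩, fun s t hs ht => ?_⟩, fun y => rfl⟩
  · change (a • K₁ y + b • K₂ y) univ = 1
    simp [hab]
  · change _ = ∫⁻ y in t, (a • K₁ y + b • K₂ y) s ∂ν
    simp only [Measure.coe_add, Measure.coe_smul, Pi.add_apply, Pi.smul_apply, smul_eq_mul]
    rw [lintegral_add_left ((K₁.measurable_coe hs).const_mul a),
      lintegral_const_mul _ (K₁.measurable_coe hs), lintegral_const_mul _ (K₂.measurable_coe hs),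
      h₁ s t hs ht, h₂ s t hs ht]

theorem IsDisint.ae_apply_compl_eq_zero {α β : Type*} [MeasurableSpace α] [MeasurableSpace β]
    {μ : Measure α} {ν : Measure β} {ρ : Measure (α × β)} {K : Kernel β α}
    (hK : IsDisint ν ρ K) (hρ : ρ ∈ Couplings μ ν) {S : Set α} (hS : MeasurableSet S)
    (hμ : μ Sᶜ = 0) : ∀ᵐ y ∂ν, K y Sᶜ = 0 := by
  have h := hK.2 Sᶜ univ hS.compl MeasurableSet.univ
  rw [Set.prod_univ, ← Measure.map_apply measurable_fst hS.compl, hρ.2.1, hμ,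
    Measure.restrict_univ, eq_comm, lintegral_eq_zero_iff (K.measurable_coe hS.compl)] at h
  exact h

theorem WFsq_prod_le {d d' : ℕ} {μ : Measure (Euc d)} {ν : Measure (Euc d')}
    [IsProbabilityMeasure μ] [IsProbabilityMeasure ν] {ρbar : Measure (Euc d × Euc d')}
    (hρbar : ρbar ∈ Couplings μ ν) {S : Set (Euc d)} (hS : MeasurableSet S) (hμ : μ Sᶜ = 0) :
    WFsq ν (μ.prod ν) ρbar ≤ Metric.ediam S ^ 2 := by
  obtain ⟨K, hK⟩ := exists_isDisint hρbar
  refine (iInf₂_le_of_le _ _ (iInf₂_le (isDisint_prod_const μ ν) hK)).trans ?_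
  have := hK.1
  calc ∫⁻ y, W2sq (Kernel.const _ μ y) (K y) ∂ν ≤ ∫⁻ _, Metric.ediam S ^ 2 ∂ν := by
        refine lintegral_mono_ae ?_
        filter_upwards [hK.ae_apply_compl_eq_zero hρbar hS hμ] with y hy
        exact W2sq_le_ediam_sq hμ hy
    _ = Metric.ediam S ^ 2 := by simp

theorem WFsq_mix_prod_le {d d' : ℕ} {μ : Measure (Euc d)} {ν : Measure (Euc d')}
    [IsProbabilityMeasure μ] [IsProbabilityMeasure ν] {ρ ρbar : Measure (Euc d × Euc d')}
    (hρbar : ρbar ∈ Couplings μ ν) {S : Set (Euc d)} (hS : MeasurableSet S) (hμ : μ Sᶜ = 0)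
    {a b : ℝ≥0∞} (hab : a + b = 1) :
    WFsq ν (a • ρ + b • μ.prod ν) ρbar ≤ WFsq ν ρ ρbar + b * Metric.ediam S ^ 2 := by
  conv_rhs => simp only [WFsq, ENNReal.iInf_add]
  refine le_iInf₂ fun K₁ K₂ => le_iInf₂ fun h₁ h₂ => ?_
  obtain ⟨K, hK, hKeq⟩ := h₁.exists_smul_add_smul (isDisint_prod_const μ ν) hab
  refine (iInf₂_le_of_le _ _ (iInf₂_le hK h₂)).trans ?_
  have := h₂.1
  calc ∫⁻ y, W2sq (K y) (K₂ y) ∂ν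
      ≤ ∫⁻ y, (W2sq (K₁ y) (K₂ y) + b * Metric.ediam S ^ 2) ∂ν := by
        refine lintegral_mono_ae ?_
        filter_upwards [h₂.ae_apply_compl_eq_zero hρbar hS hμ] with y hy
        rw [hKeq]
        refine (W2sq_smul_add_smul_le hab).trans ?_
        gcongr
        exact W2sq_le_ediam_sq hμ hy
    _ = ∫⁻ y, W2sq (K₁ y) (K₂ y) ∂ν + b * Metric.ediam S ^ 2 := by
        rw [lintegral_add_right _ measurable_const]
        simp

theorem entropyH_mix_add_le {α : Type*} [MeasurableSpace α] {π ρ σ : Measure α}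
    [IsFiniteMeasure π] [IsFiniteMeasure ρ] [IsFiniteMeasure σ] (hρ : ρ ≪ π) (hσ : σ ≪ π)
    {B : ℝ} (hB0 : 0 ≤ B) (hB : ∀ᵐ p ∂π, entT (σ.rnDeriv π p).toReal ≤ B)
    {t : ℝ} (ht : 0 < t) (ht1 : t < 1) :
    entropyH π (ENNReal.ofReal (1 - t) • ρ + ENNReal.ofReal t • σ)
        + ENNReal.ofReal (t * -Real.log t) * σ {p | ρ.rnDeriv π p = 0}
      ≤ entropyH π ρ + ENNReal.ofReal t * (ENNReal.ofReal B * π univ) := by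
  have hA : MeasurableSet {p | ρ.rnDeriv π p = 0} :=
    Measure.measurable_rnDeriv ρ π (measurableSet_singleton 0)
  have hac : ENNReal.ofReal (1 - t) • ρ + ENNReal.ofReal t • σ ≪ π :=
    (hρ.smul_left _).add_left (hσ.smul_left _)
  have := ρ.smul_finite (c := ENNReal.ofReal (1 - t)) ENNReal.ofReal_ne_top
  have := σ.smul_finite (c := ENNReal.ofReal t) ENNReal.ofReal_ne_top
  have hlog : 0 ≤ -Real.log t := neg_nonneg.2 (Real.log_nonpos ht.le ht1.le)
  rw [entropyH, if_pos hac, entropyH, if_pos hρ, ← Measure.setLIntegral_rnDeriv hσ,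
    ← lintegral_indicator hA, ← lintegral_const_mul' _ _ ENNReal.ofReal_ne_top,
    ← lintegral_const, ← lintegral_const_mul' _ _ ENNReal.ofReal_ne_top,
    ← lintegral_add_left (by have := measurable_entT; fun_prop),
    ← lintegral_add_left (by have := measurable_entT; fun_prop)]
  refine lintegral_mono_ae ?_
  filter_upwards [hB, Measure.rnDeriv_add (ENNReal.ofReal (1 - t) • ρ) (ENNReal.ofReal t • σ) π,
    Measure.rnDeriv_smul_left_of_ne_top ρ π (r := ENNReal.ofReal (1 - t)) ENNReal.ofReal_ne_top,
    Measure.rnDeriv_smul_left_of_ne_top σ π (r := ENNReal.ofReal t) ENNReal.ofReal_ne_top,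
    ρ.rnDeriv_lt_top π, σ.rnDeriv_lt_top π] with p hBp hadd hsρ hsσ hρt hσt
  rw [hadd, Pi.add_apply, hsρ, hsσ, Pi.smul_apply, Pi.smul_apply, smul_eq_mul, smul_eq_mul,
    ENNReal.toReal_add (ENNReal.mul_ne_top ENNReal.ofReal_ne_top hρt.ne)
      (ENNReal.mul_ne_top ENNReal.ofReal_ne_top hσt.ne), ENNReal.toReal_mul, ENNReal.toReal_mul,
    ENNReal.toReal_ofReal (sub_nonneg.2 ht1.le), ENNReal.toReal_ofReal ht.le,
    ← ENNReal.ofReal_mul ht.le,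
    ← ENNReal.ofReal_add (entT_nonneg ENNReal.toReal_nonneg) (mul_nonneg ht.le hB0)]
  have hmix := entT_mix_le (r := (ρ.rnDeriv π p).toReal) ENNReal.toReal_nonneg
    ENNReal.toReal_nonneg ht ht1 hBp
  have hind : ENNReal.ofReal (t * -Real.log t)
        * {p | ρ.rnDeriv π p = 0}.indicator (σ.rnDeriv π) p =
      ENNReal.ofReal (if (ρ.rnDeriv π p).toReal = 0 then
        t * -Real.log t * (σ.rnDeriv π p).toReal else 0) := by
    by_cases h0 : ρ.rnDeriv π p = 0
    · rw [Set.indicator_of_mem (by exact h0), if_pos (by simp [h0]),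
        ENNReal.ofReal_mul (p := t * -Real.log t) (by positivity), ENNReal.ofReal_toReal hσt.ne]
    · rw [Set.indicator_of_notMem (by exact h0),
        if_neg (by simp [ENNReal.toReal_eq_zero_iff, h0, hρt.ne])]
      simp
  rw [hind, ← ENNReal.ofReal_add]
  · exact ENNReal.ofReal_le_ofReal hmix
  · exact entT_nonneg (add_nonneg (mul_nonneg (sub_nonneg.2 ht1.le) ENNReal.toReal_nonneg)
      (mul_nonneg ht.le ENNReal.toReal_nonneg))
  · split_ifs <;> positivity

theorem eq_zero_of_forall_nat_mul_le {a b : ℝ≥0∞} (hb : b ≠ ⊤)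
    (h : ∀ n : ℕ, 0 < n → n * a ≤ b) : a = 0 := by
  by_contra ha
  obtain ⟨n, hn⟩ := ENNReal.exists_nat_mul_gt ha hb
  rcases Nat.eq_zero_or_pos n with rfl | hn0
  · simp at hn
  · exact (h n hn0).not_gt hn

/-- under the hypotheses of the minimizing movement step, the minimizer `ρ` of
`E_τ(·|ρ̄)` over `Γ(μ,ν)` is absolutely continuous with respect to `𝓛 ⊗ ν` and its density is
positive `μ ⊗ ν`-almost everywhere. -/
theorem stmt11 {d d' : ℕ} (U : Set (Euc d)) (X : Set (Euc d)) (Y : Set (Euc d'))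
    (hU : IsOpen U) (hUb : Bornology.IsBounded U) (hUconn : IsConnected U)
    (hXU : X = closure U)
    (hY : IsCompact Y) (hYne : Y.Nonempty)
    (V : Euc d × Euc d' → ℝ) (hV : ContDiff ℝ 2 V) (hV0 : ∀ p, 0 ≤ V p)
    (κ : ℝ) (hκ : 0 < κ) (τ : ℝ) (hτ : 0 < τ)
    (ν : Measure (Euc d')) [IsProbabilityMeasure ν] (hνY : ν Yᶜ = 0)
    (m : Euc d → ℝ) (hmMeas : Measurable m)
    (c C : ℝ) (hc : 0 < c) (hmbound : ∀ x ∈ X, c ≤ m x ∧ m x ≤ C)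
    (μ : Measure (Euc d)) [IsProbabilityMeasure μ]
    (hμ : μ = (volume.restrict X).withDensity (fun x => ENNReal.ofReal (m x)))
    (ρbar : Measure (Euc d × Euc d')) (hρbar : ρbar ∈ Couplings μ ν)
    (ρ : Measure (Euc d × Euc d')) (hρΓ : ρ ∈ Couplings μ ν)
    (hmin : ∀ σ ∈ Couplings μ ν, JKOFun X ν V κ τ ρbar ρ ≤ JKOFun X ν V κ τ ρbar σ) :
    ρ ≪ Lref X ν ∧ ∀ᵐ p ∂(μ.prod ν), 0 < ρ.rnDeriv (Lref X ν) p := by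
  have hXc : IsCompact X := hXU ▸ hUb.isCompact_closure
  have hXm : MeasurableSet X := hXc.measurableSet
  have hμX : μ Xᶜ = 0 := by
    have hac : μ ≪ volume.restrict X := hμ ▸ withDensity_absolutelyContinuous _ _
    exact hac (by rw [Measure.restrict_apply hXm.compl, Set.compl_inter_self, measure_empty])
  have : IsFiniteMeasure (volume.restrict X) :=
    ⟨by simpa using hXc.measure_lt_top⟩
  have : IsFiniteMeasure (Lref X ν) := by unfold Lref; infer_instance
  have := hρΓ.1
  set D : ℝ≥0∞ := Metric.ediam X ^ 2 with hD
  have hDt : D ≠ ⊤ := ENNReal.pow_ne_top hXc.isBounded.ediam_ne_top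
  obtain ⟨M, hM⟩ := (hXc.prod hY).bddAbove_image hV.continuous.continuousOn
  have hVprod : ∫⁻ p, ENNReal.ofReal (V p) ∂μ.prod ν ≤ ENNReal.ofReal M := by
    have h₁ : ∀ᵐ p ∂μ.prod ν, p.1 ∈ X := Measure.quasiMeasurePreserving_fst.ae hμX
    have h₂ : ∀ᵐ p ∂μ.prod ν, p.2 ∈ Y := Measure.quasiMeasurePreserving_snd.ae hνY
    calc ∫⁻ p, ENNReal.ofReal (V p) ∂μ.prod ν ≤ ∫⁻ _, ENNReal.ofReal M ∂μ.prod ν := by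
          refine lintegral_mono_ae ?_
          filter_upwards [h₁, h₂] with p hp hq
          exact ENNReal.ofReal_le_ofReal (hM (mem_image_of_mem V ⟨hp, hq⟩))
      _ = ENNReal.ofReal M := by simp
  have hdens : μ.prod ν = (Lref X ν).withDensity fun p => ENNReal.ofReal (m p.1) := by
    have : SigmaFinite ((volume.restrict X).withDensity fun x => ENNReal.ofReal (m x)) :=
      hμ ▸ inferInstance
    conv_lhs => rw [hμ]
    rw [prod_withDensity_left hmMeas.ennreal_ofReal, Lref]
  have hac : μ.prod ν ≪ Lref X ν := hdens ▸ withDensity_absolutelyContinuous _ _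
  have hB : ∀ᵐ p ∂Lref X ν, entT ((μ.prod ν).rnDeriv (Lref X ν) p).toReal ≤ C ^ 2 + 1 := by
    have h₁ : ∀ᵐ p ∂Lref X ν, p.1 ∈ X :=
      Measure.quasiMeasurePreserving_fst.ae (ae_restrict_mem hXm)
    have h₂ := Measure.rnDeriv_withDensity (Lref X ν)
      (f := fun p => ENNReal.ofReal (m p.1)) (by fun_prop)
    rw [← hdens] at h₂
    filter_upwards [h₁, h₂] with p hp hq
    obtain ⟨hcm, hmC⟩ := hmbound _ hp
    rw [hq, ENNReal.toReal_ofReal (hc.le.trans hcm)]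
    exact entT_le_sq_add_one (hc.trans_le hcm) hmC
  set Q : ℝ≥0∞ := ENNReal.ofReal (C ^ 2 + 1) * Lref X ν univ with hQ
  have hQt : Q ≠ ⊤ := ENNReal.mul_ne_top ENNReal.ofReal_ne_top (measure_ne_top _ _)
  have hEprod : entropyH (Lref X ν) (μ.prod ν) ≤ Q := by
    rw [entropyH, if_pos hac, hQ, ← lintegral_const]
    exact lintegral_mono_ae (hB.mono fun p hp => ENNReal.ofReal_le_ofReal hp)
  set K : ℝ≥0∞ := ENNReal.ofReal (1 / (2 * τ)) * D + ENNReal.ofReal M + ENNReal.ofReal κ * Q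
    with hK
  have hKt : K ≠ ⊤ := by
    simp [hK, ENNReal.mul_ne_top, hDt, hQt]
  have hJρ : JKOFun X ν V κ τ ρbar ρ ≠ ⊤ := by
    refine ne_top_of_le_ne_top hKt ((hmin _ (prod_mem_couplings μ ν)).trans ?_)
    unfold JKOFun
    rw [hK]
    gcongr
    exact WFsq_prod_le hρbar hXm hμX
  have hρac : ρ ≪ Lref X ν := by
    by_contra h
    refine hJρ ?_
    simp [JKOFun, entropyH, h, hκ]
  refine ⟨hρac, ?_⟩
  suffices hP : ENNReal.ofReal κ * μ.prod ν {p | ρ.rnDeriv (Lref X ν) p = 0} = 0 by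
    have h0 : μ.prod ν {p | ρ.rnDeriv (Lref X ν) p = 0} = 0 := by
      simpa [hκ.not_ge] using hP
    simpa [ae_iff, pos_iff_ne_zero] using h0
  refine eq_zero_of_forall_nat_mul_le hKt fun n hn => ?_
  set t : ℝ := Real.exp (-n) with ht_def
  have ht : 0 < t := Real.exp_pos _
  have ht1 : t < 1 := by simpa [ht_def] using hn
  have hlog : -Real.log t = n := by simp [ht_def]
  have hab : ENNReal.ofReal (1 - t) + ENNReal.ofReal t = 1 := by
    rw [← ENNReal.ofReal_add (sub_nonneg.2 ht1.le) ht.le]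
    simp
  have hmix := smul_add_smul_mem_couplings hab hρΓ (prod_mem_couplings μ ν)
  rw [← add_smul, hab, one_smul] at hmix
  have hent := entropyH_mix_add_le hρac hac (by positivity) hB ht ht1
  rw [hlog, ENNReal.ofReal_mul ht.le, ENNReal.ofReal_natCast, ← hQ] at hent
  have hWF := WFsq_mix_prod_le (ρ := ρ) hρbar hXm hμX hab
  have hVmix : ∫⁻ p, ENNReal.ofReal (V p) ∂(ENNReal.ofReal (1 - t) • ρ
      + ENNReal.ofReal t • μ.prod ν)
      ≤ ∫⁻ p, ENNReal.ofReal (V p) ∂ρ + ENNReal.ofReal t * ENNReal.ofReal M := by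
    rw [lintegral_add_measure, lintegral_smul_measure, lintegral_smul_measure, smul_eq_mul,
      smul_eq_mul]
    gcongr
    exact mul_le_of_le_one_left' (hab ▸ le_self_add)
  have hle := hmin _ hmix
  set P := μ.prod ν {p | ρ.rnDeriv (Lref X ν) p = 0}
  have hkey : JKOFun X ν V κ τ ρbar ρ + ENNReal.ofReal t * (n * (ENNReal.ofReal κ * P))
      ≤ JKOFun X ν V κ τ ρbar ρ + ENNReal.ofReal t * K := by
    calc JKOFun X ν V κ τ ρbar ρ + ENNReal.ofReal t * (n * (ENNReal.ofReal κ * P))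
        ≤ JKOFun X ν V κ τ ρbar (ENNReal.ofReal (1 - t) • ρ + ENNReal.ofReal t • μ.prod ν)
          + ENNReal.ofReal t * (n * (ENNReal.ofReal κ * P)) := by gcongr
      _ = ENNReal.ofReal (1 / (2 * τ))
            * WFsq ν (ENNReal.ofReal (1 - t) • ρ + ENNReal.ofReal t • μ.prod ν) ρbar
          + ∫⁻ p, ENNReal.ofReal (V p) ∂(ENNReal.ofReal (1 - t) • ρ
            + ENNReal.ofReal t • μ.prod ν)
          + ENNReal.ofReal κ
            * (entropyH (Lref X ν) (ENNReal.ofReal (1 - t) • ρ + ENNReal.ofReal t • μ.prod ν)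
              + ENNReal.ofReal t * n * P) := by
          unfold JKOFun
          ring
      _ ≤ ENNReal.ofReal (1 / (2 * τ)) * (WFsq ν ρ ρbar + ENNReal.ofReal t * D)
          + (∫⁻ p, ENNReal.ofReal (V p) ∂ρ + ENNReal.ofReal t * ENNReal.ofReal M)
          + ENNReal.ofReal κ * (entropyH (Lref X ν) ρ + ENNReal.ofReal t * Q) := by
          gcongr
      _ = JKOFun X ν V κ τ ρbar ρ + ENNReal.ofReal t * K := by
          rw [hK]
          unfold JKOFun
          ring
  exact (ENNReal.mul_le_mul_iff_right (ENNReal.ofReal_pos.2 ht).ne' ENNReal.ofReal_ne_top).1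
    (ENNReal.le_of_add_le_add_left hJρ hkey)

end
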